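/- Equivalence of non-quantified constrained terms with an extra constraint: Let ⟨X, s, φ⟩ be a non-quantified constrained term. Suppose ⊨_M φ ⇒ ⟨∃z⃗.π⟩ where {z⃗} = Var(π) \ (X ∪ Var(φ)), and Var(s) ∩ {z⃗} = ∅. Then ⟨X, s, φ⟩ ∼ ⟨X ∪ Var(π), s, φ ∧ π⟩. -/

import Mathlib

namespace LCTRS

open scoped Classical

noncomputable section

/-- First-order terms over function symbols `F` and variables `V`. -/
inductive Term (F V : Type) : Type where
  | var : V → Term F V
  | app : F → List (Term F V) → Term F V

variable {F V D : Type}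

/-- Occurrence of a variable in a term. -/
inductive Term.VarIn (x : V) : Term F V → Prop where
  | var : Term.VarIn x (Term.var x)
  | app {f : F} {ts : List (Term F V)} {t : Term F V} :
      t ∈ ts → Term.VarIn x t → Term.VarIn x (Term.app f ts)

/-- The set of variables occurring in a term. -/
def Term.vars (t : Term F V) : Set V := {x | Term.VarIn x t}

/-- Application of a substitution to a term. -/
def Term.subst (t : Term F V) (σ : V → Term F V) : Term F V :=
  match t with
  | .var x => σ x
  | .app f ts => .app f (ts.attach.map (fun u => u.1.subst σ))
decreasing_by
  have := List.sizeOf_lt_of_mem u.2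
  simp only [Term.app.sizeOf_spec] at *
  omega

/-- The domain of a substitution. -/
def substDom (σ : V → Term F V) : Set V := {x | σ x ≠ Term.var x}

/-- Positions in a term. -/
abbrev Pos := List Nat

/-- `SubtermAt s p u`: the subterm of `s` at position `p` exists and equals `u`. -/
inductive SubtermAt : Term F V → Pos → Term F V → Prop where
  | refl (t : Term F V) : SubtermAt t [] t
  | app {f : F} {ts : List (Term F V)} {i : Nat} {t u : Term F V} {p : Pos} :
      ts[i]? = some t → SubtermAt t p u → SubtermAt (Term.app f ts) (i :: p) u

/-- `ReplaceAt s p u t`: replacing the subterm of `s` at position `p` by `u` yields `t`. -/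
inductive ReplaceAt : Term F V → Pos → Term F V → Term F V → Prop where
  | here (t u : Term F V) : ReplaceAt t [] u u
  | app {f : F} {ts : List (Term F V)} {i : Nat} {p : Pos} {u t t' : Term F V} :
      ts[i]? = some t → ReplaceAt t p u t' →
      ReplaceAt (Term.app f ts) (i :: p) u (Term.app f (ts.set i t'))

/-- Replacement at a list of pairwise parallel positions (performed sequentially). -/
inductive ReplaceList : Term F V → List Pos → List (Term F V) → Term F V → Prop where
  | nil (t : Term F V) : ReplaceList t [] [] t
  | cons {t t₁ t₂ : Term F V} {p : Pos} {ps : List Pos} {u : Term F V} {us : List (Term F V)} :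
      ReplaceAt t p u t₁ → ReplaceList t₁ ps us t₂ → ReplaceList t (p :: ps) (u :: us) t₂

/-- A term is linear if each variable occurs at most once in it. -/
def Term.Linear (t : Term F V) : Prop :=
  ∀ (x : V) (p q : Pos), SubtermAt t p (Term.var x) → SubtermAt t q (Term.var x) → p = q

/-- A term is `X`-linear if each variable of `X` occurs at most once in it. -/
def Term.LinearOn (t : Term F V) (X : Set V) : Prop :=
  ∀ x ∈ X, ∀ (p q : Pos), SubtermAt t p (Term.var x) → SubtermAt t q (Term.var x) → p = q

/-- A model over the (theory part of the) signature: an interpretation of the function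
symbols over a domain `D`, a designated truth value, a set `Val` of value constants such
that every domain element is denoted by some value, and designated conjunction, equality
and truth symbols interpreted as expected. -/
structure Model (F V D : Type) where
  interp : F → List D → D
  tval : D
  Val : Set F
  andSym : F
  eqSym : F
  trueSym : F
  val_const : ∀ v ∈ Val, ∀ ds : List D, interp v ds = interp v []
  val_surj : ∀ d : D, ∃ v ∈ Val, interp v [] = d
  and_spec : ∀ a b : D, (interp andSym [a, b] = tval ↔ (a = tval ∧ b = tval))
  eq_spec : ∀ a b : D, (interp eqSym [a, b] = tval ↔ a = b)
  true_spec : interp trueSym [] = tval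

/-- Evaluation of a term in a model under a valuation. -/
def Model.eval (M : Model F V D) (ξ : V → D) (t : Term F V) : D :=
  match t with
  | .var x => ξ x
  | .app f ts => M.interp f (ts.attach.map (fun u => M.eval ξ u.1))
decreasing_by
  have := List.sizeOf_lt_of_mem u.2
  simp only [Term.app.sizeOf_spec] at *
  omega

/-- A constraint holds in `M` under the valuation `ξ`. -/
def Model.holds (M : Model F V D) (ξ : V → D) (φ : Term F V) : Prop := M.eval ξ φ = M.tval

/-- `⊨_M φ`: the constraint `φ` holds under every valuation. -/
def Model.validC (M : Model F V D) (φ : Term F V) : Prop := ∀ ξ : V → D, M.holds ξ φ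

/-- `t` is a value (a constant from `Val`). -/
def Model.IsValueTerm (M : Model F V D) (t : Term F V) : Prop := ∃ v ∈ M.Val, t = Term.app v []

/-- The root symbol of `t` is a value symbol. -/
def Model.IsValueSym (M : Model F V D) (t : Term F V) : Prop :=
  ∃ v ∈ M.Val, ∃ ts : List (Term F V), t = Term.app v ts

/-- No value occurs in `t`. -/
def Term.ValueFree (t : Term F V) (M : Model F V D) : Prop :=
  ∀ (p : Pos) (u : Term F V), SubtermAt t p u → ¬ M.IsValueSym u

/-- The conjunction `φ ∧ ψ` as a constraint. -/
def Model.conj (M : Model F V D) (φ ψ : Term F V) : Term F V := Term.app M.andSym [φ, ψ]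

/-- The equation `s = t` as a constraint. -/
def Model.eqc (M : Model F V D) (s t : Term F V) : Term F V := Term.app M.eqSym [s, t]

/-- The constraint `true`. -/
def Model.trueC (M : Model F V D) : Term F V := Term.app M.trueSym []

/-- `φ ∧ ψ₁ ∧ ⋯ ∧ ψₙ`. -/
def Model.conjFrom (M : Model F V D) (φ : Term F V) (l : List (Term F V)) : Term F V :=
  l.foldl M.conj φ

/-- `ψ₁ ∧ ⋯ ∧ ψₙ`. -/
def Model.bigConj (M : Model F V D) (l : List (Term F V)) : Term F V :=
  l.foldl M.conj M.trueC

/-- An existential constraint `⟨∃x⃗. φ⟩`: a set of (bound) variables together with a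
constraint. -/
structure EC (F V : Type) where
  bvars : Set V
  constr : Term F V

/-- Well-formedness of an existential constraint: `{x⃗} ⊆ Var(φ)`. -/
def EC.WF (c : EC F V) : Prop := c.bvars ⊆ c.constr.vars

/-- Free variables of an existential constraint. -/
def EC.fvars (c : EC F V) : Set V := c.constr.vars \ c.bvars

/-- `⟨∃x⃗. φ⟩` holds under valuation `ξ`: `φκ` holds under `ξ` for some substitution `κ`
mapping `x⃗` into `Val` (and the identity elsewhere). -/
def EC.holdsUnder (c : EC F V) (M : Model F V D) (ξ : V → D) : Prop :=
  ∃ κ : V → Term F V, (∀ x ∈ c.bvars, M.IsValueTerm (κ x)) ∧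
    (∀ x ∉ c.bvars, κ x = Term.var x) ∧ M.holds ξ (c.constr.subst κ)

/-- `⊨_M ⟨∃x⃗. φ⟩`. -/
def EC.validM (c : EC F V) (M : Model F V D) : Prop := ∀ ξ : V → D, c.holdsUnder M ξ

/-- Satisfiability of an existential constraint. -/
def EC.satisfiable (c : EC F V) (M : Model F V D) : Prop := ∃ ξ : V → D, c.holdsUnder M ξ

/-- Application of a substitution to an existential constraint acts on the free
variables only. -/
def EC.subst (c : EC F V) (σ : V → Term F V) : EC F V :=
  ⟨c.bvars, c.constr.subst (fun x => if x ∈ c.bvars then Term.var x else σ x)⟩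

/-- `⊨_M ⟨∃x⃗.φ⟩ ⇔ ⟨∃y⃗.ψ⟩`. -/
def ECIffM (M : Model F V D) (c c' : EC F V) : Prop :=
  ∀ ξ : V → D, c.holdsUnder M ξ ↔ c'.holdsUnder M ξ

/-- `σ ⊨_M ⟨∃x⃗.φ⟩`: `σ` maps the free variables into values and `(⟨∃x⃗.φ⟩)σ` is valid. -/
def SubstRespectsEC (M : Model F V D) (σ : V → Term F V) (c : EC F V) : Prop :=
  (∀ x ∈ c.fvars, M.IsValueTerm (σ x)) ∧ (c.subst σ).validM M

/-- `σ` respects the plain constraint `φ`. -/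
def SubstRespects (M : Model F V D) (σ : V → Term F V) (φ : Term F V) : Prop :=
  (∀ x ∈ φ.vars, M.IsValueTerm (σ x)) ∧ M.validC (φ.subst σ)

/-- An existentially constrained term `⟨X, s, ∃x⃗.φ⟩`. -/
structure ECTerm (F V : Type) where
  lvars : Set V
  term : Term F V
  ec : EC F V

/-- Well-formedness: `{x⃗} ⊆ Var(φ)`, `FVar(⟨∃x⃗.φ⟩) ⊆ X ⊆ Var(s)` and `{x⃗} ∩ Var(s) = ∅`. -/
def ECTerm.WF (T : ECTerm F V) : Prop :=
  T.ec.WF ∧ T.ec.fvars ⊆ T.lvars ∧ T.lvars ⊆ T.term.vars ∧ ∀ x ∈ T.ec.bvars, x ∉ T.term.vars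

/-- Satisfiability of an existentially constrained term. -/
def ECTerm.satisfiable (T : ECTerm F V) (M : Model F V D) : Prop := T.ec.satisfiable M

/-- `T` is subsumed by `T'`. -/
def SubsumedBy (M : Model F V D) (T T' : ECTerm F V) : Prop :=
  ∀ σ : V → Term F V, (∀ x ∈ T.lvars, M.IsValueTerm (σ x)) → SubstRespectsEC M σ T.ec →
    ∃ γ : V → Term F V, (∀ y ∈ T'.lvars, M.IsValueTerm (γ y)) ∧ SubstRespectsEC M γ T'.ec ∧
      T.term.subst σ = T'.term.subst γ

/-- Equivalence of existentially constrained terms. -/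
def ECEquiv (M : Model F V D) (T T' : ECTerm F V) : Prop :=
  SubsumedBy M T T' ∧ SubsumedBy M T' T

/-- An existentially constrained term is pattern-general if its term is linear in its
logical variables and contains no value. -/
def ECTerm.PatternGeneral (T : ECTerm F V) (M : Model F V D) : Prop :=
  T.term.LinearOn T.lvars ∧ T.term.ValueFree M

/-- A constrained rewrite rule `Π Z. ℓ → r [π]`. -/
structure Rule (F V : Type) where
  Z : Set V
  lhs : Term F V
  rhs : Term F V
  constr : Term F V

/-- `Var(ρ)`. -/
def Rule.vars (ρ : Rule F V) : Set V := ρ.lhs.vars ∪ ρ.rhs.vars ∪ ρ.constr.vars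

/-- `ExVar(ρ) = Var(r) \ Var(ℓ)`. -/
def Rule.exVars (ρ : Rule F V) : Set V := ρ.rhs.vars \ ρ.lhs.vars

/-- Well-formedness of a rule: `(Var(r) \ Var(ℓ)) ∪ Var(π) ⊆ Z ⊆ Var(ℓ,r,π)`. -/
def Rule.WF (ρ : Rule F V) : Prop :=
  (ρ.rhs.vars \ ρ.lhs.vars) ∪ ρ.constr.vars ⊆ ρ.Z ∧ ρ.Z ⊆ ρ.vars

/-- Left-linearity. -/
def Rule.LeftLinear (ρ : Rule F V) : Prop := ρ.lhs.Linear

/-- A rule is left-value-free if it is left-linear and no value occurs in its lhs. -/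
def Rule.LeftValueFree (ρ : Rule F V) (M : Model F V D) : Prop :=
  ρ.LeftLinear ∧ ρ.lhs.ValueFree M

/-- `ρ'` is a renamed variant of `ρ`. -/
def Rule.IsVariantOf (ρ' ρ : Rule F V) : Prop :=
  ∃ δ : V → V, Function.Bijective δ ∧
    ρ'.Z = δ '' ρ.Z ∧ ρ'.lhs = ρ.lhs.subst (fun x => Term.var (δ x)) ∧
    ρ'.rhs = ρ.rhs.subst (fun x => Term.var (δ x)) ∧
    ρ'.constr = ρ.constr.subst (fun x => Term.var (δ x))

/-- `⟨X,s,∃x⃗.φ⟩` has a `ρ`-redex at position `p` using substitution `γ`. -/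
structure RedexAt (M : Model F V D) (ρ : Rule F V) (T : ECTerm F V)
    (p : Pos) (γ : V → Term F V) : Prop where
  dom : substDom γ = ρ.lhs.vars
  matchAt : SubtermAt T.term p (ρ.lhs.subst γ)
  lvar : ∀ x ∈ ρ.lhs.vars ∩ ρ.Z, M.IsValueTerm (γ x) ∨ ∃ y ∈ T.lvars, γ x = Term.var y
  implied : ∀ ξ : V → D, T.ec.holdsUnder M ξ →
    EC.holdsUnder ⟨ρ.constr.vars \ ρ.lhs.vars, ρ.constr.subst γ⟩ M ξ

/-- A most general rewrite step at position `p` using substitution `γ`. -/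
structure MGStepData (M : Model F V D) (ρ : Rule F V) (T T' : ECTerm F V)
    (p : Pos) (γ : V → Term F V) : Prop where
  redex : RedexAt M ρ T p γ
  target : ReplaceAt T.term p (ρ.rhs.subst γ) T'.term
  cstr : T'.ec.constr = M.conj T.ec.constr (ρ.constr.subst γ)
  bnd : T'.ec.bvars = T'.ec.constr.vars \ T'.term.vars
  lv : T'.lvars = ρ.exVars ∪ (T.lvars ∩ T'.term.vars)

/-- A most general rewrite step at position `p`. -/
def MGStepAt (M : Model F V D) (ρ : Rule F V) (p : Pos) (T T' : ECTerm F V) : Prop :=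
  ∃ γ : V → Term F V, MGStepData M ρ T T' p γ

/-- A most general rewrite step. -/
def MGStep (M : Model F V D) (ρ : Rule F V) (T T' : ECTerm F V) : Prop :=
  ∃ (p : Pos) (γ : V → Term F V), MGStepData M ρ T T' p γ

/-- A non-quantified constrained term `⟨X, s, φ⟩`. -/
structure NQTerm (F V : Type) where
  lvars : Set V
  term : Term F V
  constr : Term F V

/-- Well-formedness: `Var(φ) ⊆ X ⊆ Var(φ, s)`. -/
def NQTerm.WF (T : NQTerm F V) : Prop :=
  T.constr.vars ⊆ T.lvars ∧ T.lvars ⊆ T.constr.vars ∪ T.term.vars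

/-- Satisfiability of a non-quantified constrained term. -/
def NQTerm.satisfiable (T : NQTerm F V) (M : Model F V D) : Prop :=
  ∃ ξ : V → D, M.holds ξ T.constr

/-- Subsumption of non-quantified constrained terms. -/
def NQSubsumedBy (M : Model F V D) (T T' : NQTerm F V) : Prop :=
  ∀ σ : V → Term F V, (∀ x ∈ T.lvars, M.IsValueTerm (σ x)) → SubstRespects M σ T.constr →
    ∃ γ : V → Term F V, (∀ y ∈ T'.lvars, M.IsValueTerm (γ y)) ∧ SubstRespects M γ T'.constr ∧
      T.term.subst σ = T'.term.subst γ

/-- Equivalence of non-quantified constrained terms. -/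
def NQEquiv (M : Model F V D) (T T' : NQTerm F V) : Prop :=
  NQSubsumedBy M T T' ∧ NQSubsumedBy M T' T

/-- A rewrite step on non-quantified constrained terms at position `p` using `σ`. -/
structure NQStepData (M : Model F V D) (ρ : Rule F V) (T T' : NQTerm F V)
    (p : Pos) (σ : V → Term F V) : Prop where
  fresh : Disjoint ρ.vars (T.lvars ∪ T.term.vars ∪ T.constr.vars)
  funpos : ∃ (f : F) (ts : List (Term F V)), SubtermAt T.term p (Term.app f ts)
  dom : substDom σ = ρ.vars
  matchAt : SubtermAt T.term p (ρ.lhs.subst σ)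
  zval : ∀ x ∈ ρ.Z, M.IsValueTerm (σ x) ∨ ∃ y ∈ T.lvars, σ x = Term.var y
  implied : ∀ ξ : V → D, M.holds ξ T.constr → M.holds ξ (ρ.constr.subst σ)
  target : ReplaceAt T.term p (ρ.rhs.subst σ) T'.term
  cstr : T'.constr = T.constr
  lv : T'.lvars = T.lvars ∩ (T'.term.vars ∪ T.constr.vars)

/-- A rewrite step on non-quantified constrained terms. -/
def NQStep (M : Model F V D) (ρ : Rule F V) (T T' : NQTerm F V) : Prop :=
  ∃ (p : Pos) (σ : V → Term F V), NQStepData M ρ T T' p σ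

/-- The existential removing translation `rmv`. -/
def rmv (T : ECTerm F V) : NQTerm F V := ⟨T.lvars ∪ T.ec.bvars, T.term, T.ec.constr⟩

/-- The existential extension translation `ext`. -/
def ext (T : NQTerm F V) : ECTerm F V :=
  ⟨T.lvars \ (T.constr.vars \ T.term.vars), T.term, ⟨T.constr.vars \ T.term.vars, T.constr⟩⟩

/-- Positions of `s` whose symbol is a variable of `X` or a value. -/
def PosXVal (M : Model F V D) (X : Set V) (s : Term F V) : Set Pos :=
  {p | ∃ u : Term F V, SubtermAt s p u ∧ ((∃ x ∈ X, u = Term.var x) ∨ M.IsValueSym u)}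

/-- `s'` is the bullet translation `s^{•X}` of `s`, obtained by replacing the subterms at
the positions `ps` (which enumerate `Pos_{X∪Val}(s)`) by the pairwise distinct fresh
variables `xs`. -/
structure BulletData (M : Model F V D) (X avoid : Set V) (s : Term F V)
    (ps : List Pos) (xs : List V) (s' : Term F V) : Prop where
  nodup_ps : ps.Nodup
  cover : ∀ p : Pos, p ∈ ps ↔ p ∈ PosXVal M X s
  nodup_xs : xs.Nodup
  len : xs.length = ps.length
  fresh : ∀ x ∈ xs, x ∉ avoid
  repl : ReplaceList s ps (xs.map Term.var) s'

/-- `T'` is the pattern-general translation `PG(T)` of `T` (with fresh variables chosen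
outside `avoid`). -/
def IsPG (M : Model F V D) (avoid : Set V) (T T' : ECTerm F V) : Prop :=
  ∃ (ps : List Pos) (xs : List V) (us : List (Term F V)),
    BulletData M T.lvars avoid T.term ps xs T'.term ∧
    List.Forall₂ (fun p u => SubtermAt T.term p u) ps us ∧
    T'.lvars = {x | x ∈ xs} ∧
    T'.ec.bvars = T.ec.bvars ∪ T.lvars ∧
    T'.ec.constr = M.conjFrom T.ec.constr (List.zipWith M.eqc us (xs.map Term.var))

/-- `ρh` is the left-value-free transformation `lvf(ρ)` of `ρ`. -/
def IsLVF (M : Model F V D) (ρ ρh : Rule F V) : Prop :=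
  ∃ (ps : List Pos) (xs : List V) (vs : List (Term F V)),
    ps.Nodup ∧ xs.Nodup ∧ xs.length = ps.length ∧
    (∀ p : Pos, p ∈ ps ↔ p ∈ PosXVal M (∅ : Set V) ρ.lhs) ∧
    List.Forall₂ (fun p v => SubtermAt ρ.lhs p v ∧ M.IsValueTerm v) ps vs ∧
    (∀ x ∈ xs, x ∉ ρ.vars) ∧
    ρh.Z = ρ.Z ∪ {x | x ∈ xs} ∧
    ReplaceList ρ.lhs ps (xs.map Term.var) ρh.lhs ∧
    ρh.rhs = ρ.rhs ∧
    ρh.constr = M.conjFrom ρ.constr (List.zipWith M.eqc (xs.map Term.var) vs)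

/-- A most general rewrite step with a fresh variant of some rule of the LCTRS `R`. -/
def StepR (M : Model F V D) (R : Set (Rule F V)) (T T' : ECTerm F V) : Prop :=
  ∃ ρ ∈ R, ∃ ρ' : Rule F V, ρ'.IsVariantOf ρ ∧
    Disjoint ρ'.vars (T.term.vars ∪ T.ec.constr.vars) ∧ MGStep M ρ' T T'

/-- One `∼ · →_R` step (on well-formed, satisfiable existentially constrained terms). -/
def SimStep (M : Model F V D) (R : Set (Rule F V)) (T T' : ECTerm F V) : Prop :=
  ∃ U : ECTerm F V, U.WF ∧ U.satisfiable M ∧ ECEquiv M T U ∧ StepR M R U T'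

/-- `n`-fold composition of a relation. -/
def RelPow {α : Type _} (r : α → α → Prop) : ℕ → α → α → Prop
  | 0 => fun a b => a = b
  | n + 1 => fun a c => ∃ b, r a b ∧ RelPow r n b c


theorem Term.induction_mem {P : Term F V → Prop} (var : ∀ x, P (.var x))
    (app : ∀ f ts, (∀ t ∈ ts, P t) → P (.app f ts)) (t : Term F V) : P t :=
  match t with
  | .var x => var x
  | .app f ts => app f ts fun u _ => Term.induction_mem var app u
termination_by sizeOf t
decreasing_by
  have := List.sizeOf_lt_of_mem ‹_ ∈ ts›
  simp only [Term.app.sizeOf_spec] at *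
  omega

theorem Term.subst_var (x : V) (σ : V → Term F V) : (Term.var x).subst σ = σ x := by
  rw [Term.subst]

theorem Term.subst_app (f : F) (ts : List (Term F V)) (σ : V → Term F V) :
    (Term.app f ts).subst σ = .app f (ts.map (·.subst σ)) := by
  rw [Term.subst]
  exact congrArg _ (List.attach_map_val (f := fun u : Term F V => u.subst σ))

theorem Model.eval_var (M : Model F V D) (ξ : V → D) (x : V) : M.eval ξ (.var x) = ξ x := by
  rw [Model.eval]

theorem Model.eval_app (M : Model F V D) (ξ : V → D) (f : F) (ts : List (Term F V)) :
    M.eval ξ (.app f ts) = M.interp f (ts.map (M.eval ξ)) := by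
  rw [Model.eval, List.attach_map_val (f := M.eval ξ)]

theorem Model.eval_subst (M : Model F V D) (ξ : V → D) (σ : V → Term F V) (t : Term F V) :
    M.eval ξ (t.subst σ) = M.eval (fun x => M.eval ξ (σ x)) t := by
  induction t using Term.induction_mem with
  | var x => rw [Term.subst_var, Model.eval_var]
  | app f ts ih =>
    rw [Term.subst_app, Model.eval_app, Model.eval_app, List.map_map]
    exact congrArg _ (List.map_congr_left ih)

theorem Term.subst_congr {σ τ : V → Term F V} (t : Term F V) (h : ∀ x ∈ t.vars, σ x = τ x) :
    t.subst σ = t.subst τ := by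
  induction t using Term.induction_mem with
  | var x => simpa only [Term.subst_var] using h x .var
  | app f ts ih =>
    rw [Term.subst_app, Term.subst_app]
    exact congrArg _ (List.map_congr_left fun t ht => ih t ht fun x hx => h x (.app ht hx))

theorem Model.eval_congr (M : Model F V D) {ξ ζ : V → D} (t : Term F V)
    (h : ∀ x ∈ t.vars, ξ x = ζ x) : M.eval ξ t = M.eval ζ t := by
  induction t using Term.induction_mem with
  | var x => simpa only [Model.eval_var] using h x .var
  | app f ts ih =>
    rw [Model.eval_app, Model.eval_app]
    exact congrArg _ (List.map_congr_left fun t ht => ih t ht fun x hx => h x (.app ht hx))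

theorem Model.IsValueTerm.eval_eq {M : Model F V D} {t : Term F V} (ht : M.IsValueTerm t)
    (ξ ζ : V → D) : M.eval ξ t = M.eval ζ t := by
  obtain ⟨v, -, rfl⟩ := ht
  simp only [Model.eval_app, List.map_nil]

theorem Model.vars_conj (M : Model F V D) (φ ψ : Term F V) :
    (M.conj φ ψ).vars = φ.vars ∪ ψ.vars := by
  ext x
  constructor
  · rintro (_ | ⟨ht, hx⟩)
    simp only [List.mem_cons, List.not_mem_nil, or_false] at ht
    rcases ht with rfl | rfl
    exacts [.inl hx, .inr hx]
  · rintro (hx | hx)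
    exacts [.app (by simp) hx, .app (by simp) hx]

theorem Model.holds_conj_subst (M : Model F V D) (ξ : V → D) (φ ψ : Term F V)
    (σ : V → Term F V) :
    M.holds ξ ((M.conj φ ψ).subst σ) ↔ M.holds ξ (φ.subst σ) ∧ M.holds ξ (ψ.subst σ) := by
  simp only [Model.holds, Model.conj, Term.subst_app, Model.eval_app, List.map_cons, List.map_nil,
    M.and_spec]

theorem substRespects_conj {M : Model F V D} {σ : V → Term F V} {φ ψ : Term F V} :
    SubstRespects M σ (M.conj φ ψ) ↔ SubstRespects M σ φ ∧ SubstRespects M σ ψ := by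
  simp only [SubstRespects, Model.validC, Model.vars_conj, Model.holds_conj_subst, Set.mem_union,
    or_imp, forall_and]
  tauto

/-- **Equivalence of Non-Quantified Constrained Terms with an Extra Constraint.** -/
theorem nq_equiv_with_extra_constraint {F V D : Type} (M : Model F V D)
    (T : NQTerm F V) (π : Term F V)
    (hT : T.WF)
    (himp : ∀ ξ : V → D, M.holds ξ T.constr →
      EC.holdsUnder ⟨π.vars \ (T.lvars ∪ T.constr.vars), π⟩ M ξ)
    (hdisj : Disjoint T.term.vars (π.vars \ (T.lvars ∪ T.constr.vars))) :
    NQEquiv M T ⟨T.lvars ∪ π.vars, T.term, M.conj T.constr π⟩ := by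
  constructor
  · intro σ hσ hφ
    set Z := π.vars \ (T.lvars ∪ T.constr.vars)
    let ξ : V → D := fun _ => M.tval
    obtain ⟨κ, hκ, hκ', hπ⟩ := himp (fun x => M.eval ξ (σ x))
      ((M.eval_subst ξ σ T.constr).symm.trans (hφ.2 ξ))
    let γ : V → Term F V := fun x => if x ∈ Z then κ x else σ x
    have hγZ : ∀ x ∈ Z, γ x = κ x := fun x hx => if_pos hx
    have hγσ : ∀ x ∉ Z, γ x = σ x := fun x hx => if_neg hx
    have hγ : ∀ x ∈ T.lvars ∪ π.vars, M.IsValueTerm (γ x) := by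
      intro x hx
      by_cases hxZ : x ∈ Z
      · exact hγZ x hxZ ▸ hκ x hxZ
      · rw [hγσ x hxZ]
        refine hσ x ?_
        by_contra hxT
        exact hxZ ⟨hx.resolve_left hxT, fun h => hxT (h.elim id (hT.1 ·))⟩
    have hφγ : T.constr.subst γ = T.constr.subst σ :=
      T.constr.subst_congr fun x hx => hγσ x fun h => h.2 (.inr hx)
    refine ⟨γ, hγ, substRespects_conj.2 ⟨⟨fun x hx => hγ x (.inl (hT.1 hx)), ?_⟩,
      fun x hx => hγ x (.inr hx), fun ζ => ?_⟩, ?_⟩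
    · rw [hφγ]
      exact hφ.2
    · unfold Model.holds at hπ ⊢
      rw [M.eval_subst] at hπ ⊢
      rw [← hπ]
      refine M.eval_congr π fun x hx => ?_
      by_cases hxZ : x ∈ Z
      · rw [hγZ x hxZ]
        exact (hκ x hxZ).eval_eq _ _
      · rw [hκ' x hxZ, M.eval_var, ← hγσ x hxZ]
        exact (hγ x (.inr hx)).eval_eq _ _
    · exact T.term.subst_congr fun x hx => (hγσ x (hdisj.notMem_of_mem_left hx)).symm
  · exact fun σ hσ hφ => ⟨σ, fun x hx => hσ x (.inl hx), (substRespects_conj.1 hφ).1, rfl⟩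

end

end LCTRS
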